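/- Let π be a Borel probability measure on (0,∞) with R := ∫₀^∞ r^{−1} π(dr) < ∞, let w ∈ [0,1] and M₁ ∈ (0,1). Suppose E : [0,∞) × (0,∞) → ℝ is measurable, for π-almost every r the map t ↦ E(t,r) is differentiable with ∂E/∂t(t,r) = r { −(1−wM₁) E(t,r) + (1−w) M₁ ∫₀^∞ E(t,y) π(dy) }, E(0,r) = 1, lim_{t→∞} E(t,r) = 0, and the functions (t,r) ↦ E(t,r)², (t,r) ↦ r^{−1} E(t,r) ∂E/∂t(t,r), and t ↦ (∫₀^∞ E(t,y) π(dy))² are integrable with respect to the relevant product measures. Then ∫₀^∞ ∫₀^∞ E(t,r)² π(dr) dt = (1 − wM₁)^{−1} { R/2 + (1−w) M₁ ∫₀^∞ ( ∫₀^∞ E(t,r) π(dr) )² dt }. -/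

import Mathlib

open MeasureTheory

/-- If `f` vanishes at infinity and `f * f'` is integrable on the half-line `(a, ∞)`, then
`∫ f f' = -f(a)² / 2`. -/
theorem integral_Ioi_mul_deriv_of_tendsto_zero {f f' : ℝ → ℝ} {a : ℝ}
    (hderiv : ∀ t ∈ Set.Ici a, HasDerivWithinAt f (f' t) (Set.Ici a) t)
    (hint : IntegrableOn (fun t => f t * f' t) (Set.Ioi a))
    (hlim : Filter.Tendsto f Filter.atTop (nhds 0)) :
    ∫ t in Set.Ioi a, f t * f' t = -(f a ^ 2 / 2) := by
  have hcont : ContinuousWithinAt (fun t => f t ^ 2 / 2) (Set.Ici a) a :=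
    ((hderiv a Set.self_mem_Ici).continuousWithinAt.pow 2).div_const 2
  have hderiv' : ∀ t ∈ Set.Ioi a, HasDerivAt (fun t => f t ^ 2 / 2) (f t * f' t) t := by
    intro t ht
    have h := (hderiv t (Set.Ioi_subset_Ici_self ht)).hasDerivAt (Ici_mem_nhds ht)
    exact ((h.pow 2).div_const 2).congr_deriv (by norm_num; ring)
  have hlim' : Filter.Tendsto (fun t => f t ^ 2 / 2) Filter.atTop (nhds 0) := by
    simpa using (hlim.pow 2).div_const 2
  rw [integral_Ioi_of_hasDerivAt_of_tendsto hcont hderiv' hint hlim', zero_sub]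

/-- The quadratic integral identity
`∫₀^∞ ∫ E(t,r)² π(dr) dt = (1-wM₁)⁻¹ { R/2 + (1-w)M₁ ∫₀^∞ (∫ E(t,r) π(dr))² dt }`
for solutions of the first Lyapunov equation
`∂E/∂t(t,r) = r{ -(1-wM₁) E(t,r) + (1-w) M₁ ∫ E(t,y) π(dy) }`, `E(0,·) = 1`,
with `E(t,r) → 0` as `t → ∞`. -/
theorem lyapunov_first_quadratic_identity
    (π : Measure ℝ) [IsProbabilityMeasure π] (hπ : π (Set.Iic 0) = 0)
    (R : ℝ) (hRint : IntegrableOn (fun r : ℝ => r⁻¹) (Set.Ioi 0) π)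
    (hR : R = ∫ r in Set.Ioi (0:ℝ), r⁻¹ ∂π)
    (w : ℝ) (hw : w ∈ Set.Icc (0:ℝ) 1)
    (M₁ : ℝ) (hM₁ : M₁ ∈ Set.Ioo (0:ℝ) 1)
    (E : ℝ → ℝ → ℝ) (hmeas : Measurable (fun p : ℝ × ℝ => E p.1 p.2))
    (hode : ∀ᵐ r ∂π,
      (∀ t ∈ Set.Ici (0:ℝ),
        HasDerivWithinAt (fun t' => E t' r)
          (r * (-(1 - w * M₁) * E t r +
            (1 - w) * M₁ * ∫ y in Set.Ioi (0:ℝ), E t y ∂π))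
          (Set.Ici 0) t) ∧
      E 0 r = 1 ∧
      Filter.Tendsto (fun t => E t r) Filter.atTop (nhds 0))
    (hintSq : Integrable (fun p : ℝ × ℝ => (E p.1 p.2) ^ 2)
      ((volume.restrict (Set.Ioi 0)).prod (π.restrict (Set.Ioi 0))))
    (hintED : Integrable (fun p : ℝ × ℝ =>
        p.2⁻¹ * (E p.1 p.2 *
          (p.2 * (-(1 - w * M₁) * E p.1 p.2 +
            (1 - w) * M₁ * ∫ y in Set.Ioi (0:ℝ), E p.1 y ∂π))))
      ((volume.restrict (Set.Ioi 0)).prod (π.restrict (Set.Ioi 0))))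
    (hintMean : IntegrableOn
      (fun t : ℝ => (∫ r in Set.Ioi (0:ℝ), E t r ∂π) ^ 2) (Set.Ioi 0) volume) :
    ∫ t in Set.Ioi (0:ℝ), (∫ r in Set.Ioi (0:ℝ), (E t r) ^ 2 ∂π)
      = (1 - w * M₁)⁻¹ *
        (R / 2 + (1 - w) * M₁ *
          ∫ t in Set.Ioi (0:ℝ), (∫ r in Set.Ioi (0:ℝ), E t r ∂π) ^ 2) := by
  set ν := π.restrict (Set.Ioi (0 : ℝ))
  set m : ℝ → ℝ := fun t => ∫ y, E t y ∂ν
  have hpos : ∀ᵐ r ∂ν, 0 < r := ae_restrict_mem measurableSet_Ioi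
  have time_integral : ∀ᵐ r ∂ν, ∫ t in Set.Ioi (0 : ℝ),
      r⁻¹ * (E t r * (r * (-(1 - w * M₁) * E t r + (1 - w) * M₁ * m t))) = -(r⁻¹ / 2) := by
    filter_upwards [hpos, ae_restrict_of_ae hode, hintED.prod_left_ae]
      with r hr ⟨hderiv, hzero, hlim⟩ hint
    have hint' := (integrable_const_mul_iff (inv_ne_zero hr.ne').isUnit _).mp hint
    rw [integral_const_mul, integral_Ioi_mul_deriv_of_tendsto_zero hderiv hint' hlim, hzero]
    ring
  have space_integral : ∀ᵐ t ∂(volume.restrict (Set.Ioi (0 : ℝ))), ∫ r,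
      r⁻¹ * (E t r * (r * (-(1 - w * M₁) * E t r + (1 - w) * M₁ * m t))) ∂ν
        = -(1 - w * M₁) * ∫ r, E t r ^ 2 ∂ν + (1 - w) * M₁ * m t ^ 2 := by
    filter_upwards [hintSq.prod_right_ae] with t hsq
    have hE : Integrable (E t) ν :=
      ((memLp_two_iff_integrable_sq hmeas.of_uncurry_left.aestronglyMeasurable).mpr
        hsq).integrable one_le_two
    calc _ = ∫ r, (-(1 - w * M₁) * E t r ^ 2 + (1 - w) * M₁ * m t * E t r) ∂ν := by
          refine integral_congr_ae ?_
          filter_upwards [hpos] with r hr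
          field_simp
      _ = _ := by
          rw [integral_add (hsq.const_mul _) (hE.const_mul _), integral_const_mul,
            integral_const_mul]
          ring
  have hswap := integral_integral_swap (f := fun t r =>
    r⁻¹ * (E t r * (r * (-(1 - w * M₁) * E t r + (1 - w) * M₁ * m t)))) hintED
  rw [integral_congr_ae space_integral, integral_congr_ae time_integral,
    integral_add (hintSq.integral_prod_left.const_mul _) (hintMean.const_mul _),
    integral_const_mul, integral_const_mul, integral_neg, integral_div, ← hR] at hswap
  have hne : 1 - w * M₁ ≠ 0 := by nlinarith [hw.1, hw.2, hM₁.1, hM₁.2]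
  rw [eq_inv_mul_iff_mul_eq₀ hne]
  linarith
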